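/- The graded nil-Hecke algebra ^θNH_m of type B_m — generated by π̄_1, σ̄_1,...,σ̄_{m−1} with relations σ̄_kσ̄_{k'} = σ̄_{k'}σ̄_k for |k−k'|>1, π̄_1σ̄_k = σ̄_kπ̄_1 for k ≠ 1, (π̄_1σ̄_1)² = (σ̄_1π̄_1)², σ̄_{k+1}σ̄_kσ̄_{k+1} = σ̄_kσ̄_{k+1}σ̄_k, π̄_1² = σ̄_k² = 0 — admits a spanning set {σ̄_{ẇ} : w ∈ W_m} where σ̄_{ẇ} is the product of the generators along any reduced word ẇ of w (with σ̄_m := π̄_1). In particular dim over its scalars is at most |W_m| = 2^m m!. -/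

import Mathlib

namespace Stmt13

/-- The simple reflections of the Weyl group `W_m` of type `B_m`, realized as signed
permutations (acting on `ℕ × Bool`, supported on the first `m` letters): for
`j < m - 1` the generator `tgen j` is the transposition `s_{j+1}` of the letters
`j, j+1` (with both signs), and `tgen (m-1)` is the sign change `ε₁`. -/
def tgen (m : ℕ) (j : Fin m) : Equiv.Perm (ℕ × Bool) :=
  if _h : (j : ℕ) + 1 < m then
    Equiv.swap ((j : ℕ), true) ((j : ℕ) + 1, true) *
      Equiv.swap ((j : ℕ), false) ((j : ℕ) + 1, false)
  else Equiv.swap (0, true) (0, false)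

def Xp {M : Type*} [Monoid M] (p : ℕ → M) (k : ℕ) : ℕ → M
  | 0 => 1
  | t + 1 => Xp p k t * p ((k - t) + (t - k))

def Np {M : Type*} [Monoid M] (p : ℕ → M) (c : ℕ → ℕ) : ℕ → M
  | 0 => 1
  | k + 1 => Np p c k * Xp p k (c k)

lemma Xp_map {M N : Type*} [Monoid M] [Monoid N] (f : M →* N) (p : ℕ → M) (k t : ℕ) :
    Xp (fun i => f (p i)) k t = f (Xp p k t) := by
  induction t with
  | zero => simp [Xp]
  | succ t ih => simp [Xp, ih]

lemma Np_map {M N : Type*} [Monoid M] [Monoid N] (f : M →* N) (p : ℕ → M) (c : ℕ → ℕ) (n : ℕ) :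
    Np (fun i => f (p i)) c n = f (Np p c n) := by
  induction n with
  | zero => simp [Np]
  | succ t ih => simp [Np, ih, Xp_map]

lemma Np_congr {M : Type*} [Monoid M] (p : ℕ → M) (c c' : ℕ → ℕ) (n : ℕ)
    (h : ∀ k < n, c k = c' k) : Np p c n = Np p c' n := by
  induction n with
  | zero => rfl
  | succ k ih =>
    simp only [Np]
    rw [ih (fun i hi => h i (by omega)), h k (by omega)]

lemma Xp_comm {M : Type*} [Monoid M] (p : ℕ → M) (m : ℕ)
    (hc : ∀ i j, i + 1 < j → j < m → p i * p j = p j * p i)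
    (h3 : ∀ i, 1 ≤ i → i + 1 < m → p (i + 1) * p i * p (i + 1) = p i * p (i + 1) * p i)
    (h4 : 1 < m → p 0 * p 1 * p 0 * p 1 = p 1 * p 0 * p 1 * p 0)
    (k : ℕ) (hk : k < m) (t : ℕ) : t ≤ 2 * k + 1 → ∀ j ≤ k,
    (t ≤ 2 * k → j ≠ (k - t) + (t - k)) →
    (1 ≤ t → j ≠ (k - (t - 1)) + ((t - 1) - k)) →
    ∃ j' < k, Xp p k t * p j = p j' * Xp p k t := by
  have hc' : ∀ i j, (i + 1 < j ∨ j + 1 < i) → i < m → j < m → p i * p j = p j * p i := by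
    intro i j h hi hj
    rcases h with h | h
    · exact hc i j h hj
    · exact (hc j i h hi).symm
  have h3' : ∀ i j, (i = j + 1 ∨ j = i + 1) → 1 ≤ i → 1 ≤ j → i < m → j < m →
      p i * p j * p i = p j * p i * p j := by
    intro i j h hi hj hi' hj'
    rcases h with rfl | rfl
    · exact h3 j hj hi'
    · exact (h3 i hi hj').symm
  induction t using Nat.strong_induction_on with
  | _ t ih =>
  intro ht j hj h1 h2
  match t, ih, ht, h1, h2 with
  | 0, ih, ht, h1, h2 =>
    exact ⟨j, by have := h1 (by omega); omega, by simp [Xp]⟩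
  | t + 1, ih, ht, h1, h2 =>
    obtain ⟨l, hl⟩ : ∃ l, l = (k - t) + (t - k) := ⟨_, rfl⟩
    have hjl : j ≠ l := by have := h2 (by omega); simp at this; omega
    by_cases hfar : l + 1 < j ∨ j + 1 < l
    · obtain ⟨j', hj', e⟩ := ih t (by omega) (by omega) j hj (by omega) (by omega)
      refine ⟨j', hj', ?_⟩
      simp only [Xp]
      rw [← hl, mul_assoc, hc' l j hfar (by omega) (by omega), ← mul_assoc, e, mul_assoc]
    · match t, ih, ht, h1, h2, hl with
      | 0, ih, ht, h1, h2, hl => 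
        exfalso
        have := h1
        omega
      | t + 1, ih, ht, h1, h2, hl =>
        have hj2 : j = (k - t) + (t - k) := by
          by_cases hh : t + 1 + 1 ≤ 2 * k
          · have := h1 hh; omega
          · omega
        by_cases hkt : t = k
        · subst hkt
          have hj0 : j = 0 := by omega
          have hl1 : l = 1 := by omega
          subst hj0
          match t, ih, ht, h1, h2, hl, hk with
          | 0, ih, ht, h1, h2, hl, hk => omega
          | t + 1, ih, ht, h1, h2, hl, hk =>
            obtain ⟨j', hj', e⟩ := ih t (by omega) (by omega) 0 (by omega) (by omega) (by omega)
            refine ⟨j', hj', ?_⟩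
            simp only [Xp]
            rw [← hl, ← hj2, hl1]
            have e1 : t + 1 - t + (t - (t + 1)) = 1 := by omega
            rw [e1]
            have := h4 (by omega)
            calc _ = Xp p (t+1) t * (p 1 * p 0 * p 1 * p 0) := by simp only [mul_assoc]
              _ = (Xp p (t+1) t * p 0) * (p 1 * p 0 * p 1) := by
                rw [← this]; simp only [mul_assoc]
              _ = _ := by rw [e]; simp only [mul_assoc]
        · obtain ⟨j', hj', e⟩ := ih t (by omega) (by omega) l (by omega) (by omega) (by omega)
          refine ⟨j', hj', ?_⟩
          simp only [Xp]
          rw [← hl, ← hj2]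
          have := h3' j l (by omega) (by omega) (by omega) (by omega) (by omega)
          calc _ = Xp p k t * (p j * p l * p j) := by simp only [mul_assoc]
            _ = (Xp p k t * p l) * (p j * p l) := by
                rw [this]; simp only [mul_assoc]
            _ = _ := by rw [e]; simp only [mul_assoc]

lemma Np_step {M : Type*} [Monoid M] (p : ℕ → M) (m : ℕ)
    (hc : ∀ i j, i + 1 < j → j < m → p i * p j = p j * p i)
    (h3 : ∀ i, 1 ≤ i → i + 1 < m → p (i + 1) * p i * p (i + 1) = p i * p (i + 1) * p i)
    (h4 : 1 < m → p 0 * p 1 * p 0 * p 1 = p 1 * p 0 * p 1 * p 0)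
    (R : M → M → Prop) (hrefl : ∀ u, R u u)
    (hmul : ∀ u v w, R u v → R (u * w) (v * w))
    (hsq : ∀ u, ∀ i < m, R (u * p i * p i) u)
    (n : ℕ) : n ≤ m → ∀ c : ℕ → ℕ, (∀ k, c k < 2 * (k + 1)) → ∀ j < n,
    ∃ c' : ℕ → ℕ, (∀ k, c' k < 2 * (k + 1)) ∧ R (Np p c n * p j) (Np p c' n) := by
  have upd : ∀ (c : ℕ → ℕ) (k t : ℕ), (∀ k, c k < 2 * (k + 1)) → t < 2 * (k + 1) →
      (∀ i, Function.update c k t i < 2 * (i + 1)) ∧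
      Np p (Function.update c k t) (k + 1) = Np p c k * Xp p k t := by
    intro c k t h ht
    constructor
    · intro i
      by_cases hi : i = k
      · subst hi; simpa using ht
      · simpa [hi] using h i
    · simp only [Np, Function.update_self]
      rw [Np_congr p _ c k]
      intro i hi
      simp [hi.ne]
  induction n with
  | zero => intro _ c _ j hj; omega
  | succ k ih =>
    intro hk c hcv j hj
    have hck := hcv k
    by_cases e1 : c k ≤ 2 * k ∧ j = (k - c k) + (c k - k)
    · obtain ⟨hv, hN⟩ := upd c k (c k + 1) hcv (by omega)
      refine ⟨_, hv, ?_⟩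
      rw [hN]
      simp only [Np, Xp]
      rw [← e1.2, mul_assoc]
      exact hrefl _
    by_cases e2 : 1 ≤ c k ∧ j = (k - (c k - 1)) + ((c k - 1) - k)
    · obtain ⟨hv, hN⟩ := upd c k (c k - 1) hcv (by omega)
      refine ⟨_, hv, ?_⟩
      rw [hN]
      obtain ⟨t, ht⟩ : ∃ t, c k = t + 1 := ⟨c k - 1, by omega⟩
      rw [ht] at e2
      simp only [Np, ht, Xp, Nat.add_sub_cancel] at e2 ⊢
      rw [← e2.2, ← mul_assoc]
      exact hsq _ _ (by omega)
    · obtain ⟨j', hj', e⟩ := Xp_comm p m hc h3 h4 k (by omega) (c k) (by omega) j (by omega)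
        (by tauto) (by tauto)
      obtain ⟨c', hv', hR⟩ := ih (by omega) c hcv j' hj'
      obtain ⟨hv, hN⟩ := upd c' k (c k) hv' (by omega)
      refine ⟨_, hv, ?_⟩
      rw [hN]
      simp only [Np]
      rw [mul_assoc, e, ← mul_assoc]
      exact hmul _ _ _ hR

/-- simple reflections, reindexed. -/
def sg : ℕ → Equiv.Perm (ℕ × Bool)
  | 0 => Equiv.swap (0, true) (0, false)
  | i + 1 => Equiv.swap (i, true) (i + 1, true) * Equiv.swap (i, false) (i + 1, false)

lemma sg_zero (n : ℕ) (b : Bool) : sg 0 (n, b) = (n, if n = 0 then !b else b) := by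
  cases b <;> simp [sg, Equiv.swap_apply_def] <;> grind

lemma sg_succ (i n : ℕ) (b : Bool) :
    sg (i + 1) (n, b) = (if n = i then i + 1 else if n = i + 1 then i else n, b) := by
  cases b <;> simp [sg, Equiv.swap_apply_def] <;> grind

lemma sg_sq (i : ℕ) : sg i * sg i = 1 := by
  ext1 ⟨n, b⟩
  cases i with
  | zero => simp only [Equiv.Perm.mul_apply, sg_zero]; cases b <;> simp <;> grind
  | succ i => simp only [Equiv.Perm.mul_apply, sg_succ, Equiv.Perm.one_apply]; grind

lemma sg_comm (i j : ℕ) (h : i + 1 < j) : sg i * sg j = sg j * sg i := by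
  obtain ⟨j, rfl⟩ : ∃ j', j = j' + 1 := ⟨j - 1, by omega⟩
  ext1 ⟨n, b⟩
  cases i with
  | zero => simp only [Equiv.Perm.mul_apply, sg_zero, sg_succ]; grind
  | succ i => simp only [Equiv.Perm.mul_apply, sg_succ]; grind

lemma sg_b3 (i : ℕ) (h : 1 ≤ i) : sg (i + 1) * sg i * sg (i + 1) = sg i * sg (i + 1) * sg i := by
  obtain ⟨i, rfl⟩ : ∃ j', i = j' + 1 := ⟨i - 1, by omega⟩
  ext1 ⟨n, b⟩
  simp only [Equiv.Perm.mul_apply, sg_succ]; grind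

lemma sg_b4 : sg 0 * sg 1 * sg 0 * sg 1 = sg 1 * sg 0 * sg 1 * sg 0 := by
  ext1 ⟨n, b⟩
  have h1 := sg_succ 0
  simp only [zero_add] at h1
  simp only [Equiv.Perm.mul_apply, sg_zero, h1]; grind

def ek (k t : ℕ) : ℕ × Bool := if t ≤ k then (k - t, true) else (t - k - 1, false)

lemma sg_ek (k t : ℕ) : sg ((k - t) + (t - k)) (ek k (t + 1)) = ek k t := by
  rcases lt_trichotomy t k with h | h | h
  · obtain ⟨d, rfl⟩ : ∃ d, k = t + (d + 1) := ⟨k - t - 1, by omega⟩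
    have e : t + (d + 1) - t + (t - (t + (d + 1))) = d + 1 := by omega
    rw [e]
    simp only [ek]
    rw [if_pos (by omega), if_pos (by omega), sg_succ]
    grind
  · subst h
    simp [ek, sg_zero]
  · obtain ⟨d, rfl⟩ : ∃ d, t = k + (d + 1) := ⟨t - k - 1, by omega⟩
    have e : k - (k + (d + 1)) + (k + (d + 1) - k) = d + 1 := by omega
    rw [e]
    simp only [ek]
    rw [if_neg (by omega), if_neg (by omega), sg_succ]
    grind

lemma Xp_ek (k t : ℕ) : Xp sg k t (ek k t) = (k, true) := by
  induction t with
  | zero => simp [Xp, ek]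
  | succ t ih => simp only [Xp, Equiv.Perm.mul_apply, sg_ek, ih]

lemma sg_fix (i n : ℕ) (h : i < n) (b : Bool) : sg i (n, b) = (n, b) := by
  cases i with
  | zero => rw [sg_zero]; grind
  | succ i => rw [sg_succ]; grind

lemma Xp_fix (k t n : ℕ) (ht : t < 2 * (k + 1)) (h : k < n) (b : Bool) :
    Xp sg k t (n, b) = (n, b) := by
  induction t with
  | zero => simp [Xp]
  | succ t ih =>
    simp only [Xp, Equiv.Perm.mul_apply]
    rw [sg_fix _ _ (by omega), ih (by omega)]

lemma Np_fix (c : ℕ → ℕ) (hv : ∀ k, c k < 2 * (k + 1)) (k n : ℕ) (h : k ≤ n) (b : Bool) :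
    Np sg c k (n, b) = (n, b) := by
  induction k with
  | zero => simp [Np]
  | succ t ih =>
    simp only [Np, Equiv.Perm.mul_apply]
    rw [Xp_fix _ _ _ (hv t) (by omega), ih (by omega)]

lemma Np_inj (c c' : ℕ → ℕ) (hv : ∀ k, c k < 2 * (k + 1)) (hv' : ∀ k, c' k < 2 * (k + 1))
    (n : ℕ) (h : Np sg c n = Np sg c' n) : ∀ k < n, c k = c' k := by
  induction n with
  | zero => intro k hk; omega
  | succ n ih =>
    have a1 : Np sg c (n + 1) (ek n (c n)) = (n, true) := by
      simp only [Np, Equiv.Perm.mul_apply, Xp_ek]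
      exact Np_fix c hv n n le_rfl _
    have a2 : Np sg c' (n + 1) (ek n (c' n)) = (n, true) := by
      simp only [Np, Equiv.Perm.mul_apply, Xp_ek]
      exact Np_fix c' hv' n n le_rfl _
    rw [h, ← a2] at a1
    have e := (Np sg c' (n + 1)).injective a1
    have en : c n = c' n := by
      have := hv n
      have := hv' n
      simp only [ek] at e
      split_ifs at e <;> simp at e <;> omega
    simp only [Np, en] at h
    have := ih (mul_right_cancel h)
    intro k hk
    by_cases hkn : k = n
    · rw [hkn, en]
    · exact this k (by omega)

def ind (m j : ℕ) : ℕ := if j + 1 < m then j + 1 else 0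

lemma exists_word_X {M : Type*} [Monoid M] (p : ℕ → M) (m k t : ℕ) (hk : k < m)
    (ht : t < 2 * (k + 1)) :
    ∃ ω : List (Fin m), (ω.map fun j : Fin m => p (ind m j)).prod = Xp p k t := by
  induction t with
  | zero => exact ⟨[], by simp [Xp]⟩
  | succ t ih =>
    obtain ⟨ω, h⟩ := ih (by omega)
    obtain ⟨i, hi⟩ : ∃ i, i = (k - t) + (t - k) := ⟨_, rfl⟩
    have : ∃ j : Fin m, ind m j = i := by
      by_cases h0 : i = 0
      · exact ⟨⟨m - 1, by omega⟩, by simp only [ind]; split_ifs <;> omega⟩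
      · exact ⟨⟨i - 1, by omega⟩, by simp only [ind]; split_ifs <;> omega⟩
    obtain ⟨j, hj⟩ := this
    exact ⟨ω ++ [j], by simp [Xp, h, hj, hi]⟩

lemma exists_word {M : Type*} [Monoid M] (p : ℕ → M) (m : ℕ) (c : ℕ → ℕ)
    (hv : ∀ k, c k < 2 * (k + 1)) (n : ℕ) (hn : n ≤ m) :
    ∃ ω : List (Fin m), (ω.map fun j : Fin m => p (ind m j)).prod = Np p c n := by
  induction n with
  | zero => exact ⟨[], by simp [Np]⟩
  | succ k ih =>
    obtain ⟨ω, h⟩ := ih (by omega)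
    obtain ⟨ω', h'⟩ := exists_word_X p m k (c k) (by omega) (hv k)
    exact ⟨ω ++ ω', by simp [Np, h, h']⟩

lemma tgen_eq (m : ℕ) (j : Fin m) : tgen m j = sg (ind m j) := by
  unfold tgen ind
  split_ifs <;> rfl

lemma card_c (m : ℕ) : Fintype.card ((k : Fin m) → Fin (2 * ((k : ℕ) + 1))) =
    2 ^ m * Nat.factorial m := by
  rw [Fintype.card_pi]
  simp only [Fintype.card_fin]
  rw [Finset.prod_mul_distrib, Fin.prod_univ_eq_prod_range (fun k => k + 1) m,
    Finset.prod_range_add_one_eq_factorial]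
  simp

lemma key {A : Type*} [Ring A]
    (m : ℕ) (g : ℕ → A)
    (hsq : ∀ k < m, g k * g k = 0)
    (hcomm : ∀ k l, k + 1 < l → l < m - 1 → g k * g l = g l * g k)
    (hpic : ∀ k, 1 ≤ k → k < m - 1 → g (m - 1) * g k = g k * g (m - 1))
    (hbraid4 : 1 < m →
      g (m - 1) * g 0 * g (m - 1) * g 0 = g 0 * g (m - 1) * g 0 * g (m - 1))
    (hbraid3 : ∀ k, k + 2 < m → g (k + 1) * g k * g (k + 1) = g k * g (k + 1) * g k)
    (a : ℕ → A) (ha : a = fun i => if i = 0 then g (m - 1) else g (i - 1)) :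
    ∀ ω : List (Fin m), ∃ c : ℕ → ℕ, (∀ k, c k < 2 * (k + 1)) ∧
      (∃ ν : List (Fin m), ν.length ≤ ω.length ∧
        (ν.map (tgen m)).prod = Np sg c m ∧ (ν.map fun j : Fin m => g (j : ℕ)).prod = Np a c m) ∧
      (ω.map (tgen m)).prod = Np sg c m ∧
      ((ω.map fun j : Fin m => g (j : ℕ)).prod = Np a c m ∨ (ω.map fun j : Fin m => g (j : ℕ)).prod = 0) := by
  have hga : ∀ j : Fin m, g j = a (ind m j) := by
    intro j
    have := j.2
    simp only [ha, ind]
    by_cases h1 : (j : ℕ) + 1 < m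
    · simp [h1]
    · simp only [h1, if_false, if_true]
      congr 1; omega
  have ha0 : a 0 = g (m - 1) := by simp [ha]
  have has : ∀ i, a (i + 1) = g i := by simp [ha]
  have ac : ∀ i j, i + 1 < j → j < m → a i * a j = a j * a i := by
    intro i j h hj
    obtain ⟨j, rfl⟩ : ∃ j', j = j' + 1 := ⟨j - 1, by omega⟩
    cases i with
    | zero => rw [ha0, has]; exact hpic j (by omega) (by omega)
    | succ i => rw [has, has]; exact hcomm i j (by omega) (by omega)
  have a3 : ∀ i, 1 ≤ i → i + 1 < m → a (i + 1) * a i * a (i + 1) = a i * a (i + 1) * a i := by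
    intro i h hi
    obtain ⟨i, rfl⟩ : ∃ j', i = j' + 1 := ⟨i - 1, by omega⟩
    rw [has, has]; exact hbraid3 i (by omega)
  have a4 : 1 < m → a 0 * a 1 * a 0 * a 1 = a 1 * a 0 * a 1 * a 0 := by
    intro h
    rw [ha0, has 0]; exact hbraid4 h
  have asq : ∀ i < m, a i * a i = 0 := by
    intro i hi
    cases i with
    | zero => rw [ha0]; exact hsq _ (by omega)
    | succ i => rw [has]; exact hsq _ (by omega)
  obtain ⟨P, hP⟩ : ∃ P : ℕ → Multiplicative ℕ × Equiv.Perm (ℕ × Bool) × A,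
    P = fun i => (Multiplicative.ofAdd 1, sg i, a i) := ⟨_, rfl⟩
  obtain ⟨R, hR⟩ : ∃ R : (Multiplicative ℕ × Equiv.Perm (ℕ × Bool) × A) →
      (Multiplicative ℕ × Equiv.Perm (ℕ × Bool) × A) → Prop,
    R = fun u v => v.1.toAdd ≤ u.1.toAdd ∧ u.2.1 = v.2.1 ∧ (u.2.2 = v.2.2 ∨ u.2.2 = 0) := ⟨_, rfl⟩
  have hmul : ∀ u v w, R u v → R (u * w) (v * w) := by
    intro u v w h
    simp only [hR] at h ⊢
    obtain ⟨h1, h2, h3⟩ := h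
    refine ⟨by simpa using h1, by simp [h2], ?_⟩
    rcases h3 with h3 | h3
    · left; simp [h3]
    · right; simp [h3]
  have htrans : ∀ u v w, R u v → R v w → R u w := by
    intro u v w h h'
    simp only [hR] at h h' ⊢
    obtain ⟨h1, h2, h3⟩ := h
    obtain ⟨h1', h2', h3'⟩ := h'
    refine ⟨h1'.trans h1, h2.trans h2', ?_⟩
    rcases h3 with h3 | h3
    · rw [h3]; exact h3'
    · right; exact h3
  have hrefl : ∀ u, R u u := by intro u; simp [hR]
  have step := Np_step P m
    (by intro i j h hj; simp only [hP, Prod.mk_mul_mk, sg_comm i j h, ac i j h hj])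
    (by intro i h hj; simp only [hP, Prod.mk_mul_mk, sg_b3 i h, a3 i h hj])
    (by intro h; simp only [hP, Prod.mk_mul_mk, sg_b4, a4 h])
    R hrefl hmul
    (by
      intro u i hi
      rw [mul_assoc]
      simp only [hP, hR, Prod.mk_mul_mk, sg_sq, asq i hi]
      refine ⟨by simp, by simp, Or.inr (by simp)⟩) m le_rfl
  have all : ∀ ω : List (Fin m), ∃ c : ℕ → ℕ, (∀ k, c k < 2 * (k + 1)) ∧
      R (ω.map fun j : Fin m => P (ind m j)).prod (Np P c m) := by
    intro ω
    induction ω using List.reverseRecOn with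
    | nil =>
      refine ⟨fun _ => 0, by intro k; simp, ?_⟩
      have : ∀ n, Np P (fun _ => 0) n = 1 := by
        intro n
        induction n with
        | zero => rfl
        | succ n ih => simp [Np, Xp, ih]
      rw [this]
      exact hrefl _
    | append_singleton ω j ih =>
      obtain ⟨c, hv, h⟩ := ih
      have hj : ind m j < m := by have := j.2; simp only [ind]; split_ifs <;> omega
      obtain ⟨c', hv', h'⟩ := step c hv _ hj
      refine ⟨c', hv', htrans _ _ _ ?_ h'⟩
      simp only [List.map_append, List.prod_append, List.map_cons, List.map_nil, List.prod_singleton]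
      exact hmul _ _ _ h
  have comp : ∀ ω : List (Fin m), (ω.map fun j : Fin m => P (ind m j)).prod =
      (Multiplicative.ofAdd ω.length, (ω.map (tgen m)).prod, (ω.map fun j : Fin m => g (j : ℕ)).prod) := by
    intro ω
    induction ω with
    | nil => rfl
    | cons j ω ih =>
      simp only [List.map_cons, List.prod_cons, ih]
      simp only [hP, Prod.mk_mul_mk, tgen_eq, hga, List.length_cons, ofAdd_add]
      rw [mul_comm (Multiplicative.ofAdd 1)]
  intro ω
  obtain ⟨c, hv, h⟩ := all ω
  obtain ⟨ν, hν⟩ := exists_word P m c hv m le_rfl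
  have n1 : (Np P c m).2.1 = Np sg c m := by
    have := Np_map ((MonoidHom.fst _ _).comp (MonoidHom.snd _ _)) P c m
    simp only [hP] at this ⊢
    exact this.symm
  have n2 : (Np P c m).2.2 = Np a c m := by
    have := Np_map ((MonoidHom.snd _ _).comp (MonoidHom.snd _ _)) P c m
    simp only [hP] at this ⊢
    exact this.symm
  have hν1 := hν
  rw [comp] at hν1
  rw [comp] at h
  simp only [hR] at h
  refine ⟨c, hv, ?_⟩
  rw [← n1, ← n2]
  refine ⟨⟨ν, ?_, ?_, ?_⟩, h.2.1, h.2.2⟩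
  · have := h.1
    rw [← hν1] at this
    exact this
  · rw [← hν1]
  · rw [← hν1]

lemma conv {A : Type*} [Ring A] (m : ℕ) (g : ℕ → A) (ω : List (Fin m)) :
    (ω.map fun j => g (j : ℕ)).prod = (ω.map fun j : Fin m => g (j : ℕ)).prod := by
  induction ω with
  | nil => rfl
  | cons a ω ih =>
    simp only [List.map_cons, List.prod_cons, ← ih]
    simp [List.flatMap_cons]

/-- The nil-Hecke algebra of type `B_m` — given by generators
`σ̄₁, ..., σ̄_{m-1}, π̄₁` (here `g 0, ..., g (m-2), g (m-1)`) and the nil-Hecke relations —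
is spanned by the products `σ̄_ẇ` of generators along reduced words `ẇ` of elements
`w ∈ W_m` (reduced = of minimal length among all words representing the same element of
the signed permutation group `W_m`). In particular its dimension over the scalars is at
most `|W_m| = 2^m m!`. -/
theorem stmt13 {K : Type*} [Field K] {A : Type*} [Ring A] [Algebra K A]
    (m : ℕ) (hm : 0 < m) (g : ℕ → A)
    (hsq : ∀ k < m, g k * g k = 0)
    (hcomm : ∀ k l, k + 1 < l → l < m - 1 → g k * g l = g l * g k)
    (hpic : ∀ k, 1 ≤ k → k < m - 1 → g (m - 1) * g k = g k * g (m - 1))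
    (hbraid4 : 1 < m →
      g (m - 1) * g 0 * g (m - 1) * g 0 = g 0 * g (m - 1) * g 0 * g (m - 1))
    (hbraid3 : ∀ k, k + 2 < m → g (k + 1) * g k * g (k + 1) = g k * g (k + 1) * g k) :
    (Subalgebra.toSubmodule (Algebra.adjoin K (Set.range fun j : Fin m => g (j : ℕ))) ≤
      Submodule.span K {x : A | ∃ ω : List (Fin m),
        (∀ ω' : List (Fin m), (ω'.map (tgen m)).prod = (ω.map (tgen m)).prod →
          ω.length ≤ ω'.length) ∧
        x = (ω.map fun j => g (j : ℕ)).prod}) ∧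
    Module.finrank K (Algebra.adjoin K (Set.range fun j : Fin m => g (j : ℕ)))
      ≤ 2 ^ m * Nat.factorial m := by
  obtain ⟨a, ha⟩ : ∃ a : ℕ → A, a = fun i => if i = 0 then g (m - 1) else g (i - 1) := ⟨_, rfl⟩
  have K0 := key m g hsq hcomm hpic hbraid4 hbraid3 a ha
  rw [Algebra.adjoin_eq_span]
  have words : ∀ x ∈ Submonoid.closure (Set.range fun j : Fin m => g (j : ℕ)),
      ∃ ω : List (Fin m), x = (ω.map fun j : Fin m => g (j : ℕ)).prod := by
    intro x hx
    induction hx using Submonoid.closure_induction with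
    | mem x hx => obtain ⟨j, rfl⟩ := hx; exact ⟨[j], by simp⟩
    | one => exact ⟨[], by simp⟩
    | mul x y _ _ h1 h2 =>
      obtain ⟨u, rfl⟩ := h1
      obtain ⟨v, rfl⟩ := h2
      exact ⟨u ++ v, by simp⟩
  constructor
  · rw [Submodule.span_le]
    intro x hx
    obtain ⟨ω, rfl⟩ := words x hx
    obtain ⟨ω₁, hω₁, hmin⟩ : ∃ ω₁ : List (Fin m),
        (ω₁.map (tgen m)).prod = (ω.map (tgen m)).prod ∧
        ∀ ω' : List (Fin m), (ω'.map (tgen m)).prod = (ω.map (tgen m)).prod →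
          ω₁.length ≤ ω'.length := by
      obtain ⟨w, hw, hm'⟩ := WellFounded.has_min
        (measure (List.length : List (Fin m) → ℕ)).wf
        {ω' | (ω'.map (tgen m)).prod = (ω.map (tgen m)).prod} ⟨ω, rfl⟩
      exact ⟨w, hw, fun v hv => not_lt.1 (hm' v hv)⟩
    obtain ⟨c, hv, -, e1, e2⟩ := K0 ω
    obtain ⟨c', hv', ⟨ν, hl, f1, f2⟩, f3, -⟩ := K0 ω₁
    have hcc := Np_inj c c' hv hv' m (by rw [← e1, ← f3, hω₁])
    rcases e2 with e2 | e2
    · apply Submodule.subset_span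
      refine ⟨ν, ?_, ?_⟩
      · intro ω' h'
        refine hl.trans (hmin ω' ?_)
        rw [h', f1, ← f3, hω₁]
      · rw [e2, conv, f2]
        exact Np_congr a c c' m hcc
    · simp only [e2]
      exact Submodule.zero_mem _
  · rw [← Subalgebra.finrank_toSubmodule, Algebra.adjoin_eq_span]
    let F : ((k : Fin m) → Fin (2 * ((k : ℕ) + 1))) → A := fun f =>
      Np a (fun k => if h : k < m then (f ⟨k, h⟩ : ℕ) else 0) m
    have hle : Submodule.span K (Submonoid.closure (Set.range fun j : Fin m => g (j : ℕ)) : Set A)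
        ≤ Submodule.span K (Set.range F) := by
      rw [Submodule.span_le]
      intro x hx
      obtain ⟨ω, rfl⟩ := words x hx
      obtain ⟨c, hv, -, e1, e2⟩ := K0 ω
      rcases e2 with e2 | e2
      · apply Submodule.subset_span
        refine ⟨fun k => ⟨c k, hv k⟩, ?_⟩
        rw [e2]
        apply Np_congr
        intro k hk
        simp [hk]
      · simp only [e2]
        exact Submodule.zero_mem _
    haveI : Module.Finite K (Submodule.span K (Set.range F)) :=
      Module.Finite.span_of_finite K (Set.finite_range F)
    rw [← card_c]
    exact (Submodule.finrank_mono hle).trans (finrank_range_le_card F)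

end Stmt13
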